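/- For integers k ≥ 1 let ξ_k = k^{−1/2}, let θ_k ∈ (0,π) be defined by cos θ_k = (cos(ξ_k − ξ_{k+1}) + 1)/2, fix a ∈ (−π/2, π/2], let t_k(a) = 1/cos(a − Σ_{i=k}^∞ θ_i) and p_k = (t_k(a) cos ξ_k, t_k(a) sin ξ_k, t_k(a)), defined for all k ≥ k₀(a) where a − Σ_{i=k}^∞ θ_i ∈ (−π/2, π/2). Let l_k be the line through p_k and p_{k+1}. Then for every k ≥ k₀(a), the distance from l_k to the origin equals √2. -/

import Mathlib

open Real Filter

noncomputable section

/-- For every `k ≥ k₀(a)`, the line `l_k` through the points `p_k` and `p_{k+1}` of the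
constructed polygonal line is at distance `√2` from the origin. -/
theorem stmt_9 (ξ θ : ℕ → ℝ)
    (hξ : ∀ k : ℕ, ξ k = (k : ℝ) ^ (-(1 : ℝ) / 2))
    (hθmem : ∀ k : ℕ, 1 ≤ k → θ k ∈ Set.Ioo 0 π)
    (hθ : ∀ k : ℕ, 1 ≤ k → Real.cos (θ k) = (Real.cos (ξ k - ξ (k + 1)) + 1) / 2)
    (a : ℝ) (ha : a ∈ Set.Ioc (-(π / 2)) (π / 2))
    (k₀ : ℕ) (hk₀ : 1 ≤ k₀)
    (hk₀a : ∀ k : ℕ, k₀ ≤ k → (a - ∑' i : ℕ, θ (k + i)) ∈ Set.Ioo (-(π / 2)) (π / 2))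
    (t : ℕ → ℝ) (ht : ∀ k : ℕ, t k = 1 / Real.cos (a - ∑' i : ℕ, θ (k + i)))
    (p : ℕ → EuclideanSpace ℝ (Fin 3))
    (hp : ∀ k : ℕ, p k 0 = t k * Real.cos (ξ k) ∧ p k 1 = t k * Real.sin (ξ k) ∧
      p k 2 = t k)
    (k : ℕ) (hk : k₀ ≤ k) :
    Metric.infDist (0 : EuclideanSpace ℝ (Fin 3))
        {y | ∃ s : ℝ, y = p k + s • (p (k + 1) - p k)} = Real.sqrt 2 := by
  have hk1 : 1 ≤ k := le_trans hk₀ hk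
  have hξ0 : ∀ n, 0 ≤ ξ n := fun n => by rw [hξ]; positivity
  have hξ1 : ∀ n, 1 ≤ n → ξ n ≤ 1 := fun n hn => by
    rw [hξ]
    exact Real.rpow_le_one_of_one_le_of_nonpos (by exact_mod_cast hn) (by norm_num)
  have hξm : ∀ n, 1 ≤ n → ξ (n + 1) ≤ ξ n := fun n hn => by
    rw [hξ, hξ]
    apply Real.rpow_le_rpow_of_nonpos
    · exact_mod_cast hn
    · push_cast; linarith
    · norm_num
  have hle : ∀ n, 1 ≤ n → θ n ≤ ξ n - ξ (n + 1) := fun n hn => by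
    by_contra hcon
    push Not at hcon
    have h1 := hξ0 (n + 1)
    have h2 := hξ1 n hn
    have h3 := hξm n hn
    have h4 := Real.cos_lt_cos_of_nonneg_of_le_pi (by linarith) (hθmem n hn).2.le hcon
    have h5 := hθ n hn
    have h6 := Real.cos_le_one (ξ n - ξ (n + 1))
    linarith
  have hsum : Summable (fun i => θ (k + i)) := by
    apply summable_of_sum_range_le (c := ξ k)
    · intro i
      exact (hθmem (k + i) (by omega)).1.le
    · intro n
      have : ∑ i ∈ Finset.range n, θ (k + i) ≤ ξ k - ξ (k + n) := by
        induction n with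
        | zero => simp
        | succ n ih =>
          rw [Finset.sum_range_succ]
          have := hle (k + n) (by omega)
          rw [← add_assoc]
          linarith
      linarith [hξ0 (k + n)]
  have hS : ∑' i : ℕ, θ (k + i) = θ k + ∑' i : ℕ, θ (k + 1 + i) := by
    rw [hsum.tsum_eq_zero_add]
    simp only [add_zero]
    congr 2
    funext i
    congr 1
    ring
  obtain ⟨hθ0, hθπ⟩ := hθmem k hk1
  have hA := hk₀a k hk
  have hB := hk₀a (k + 1) (by omega)
  have htA := ht k
  have htB := ht (k + 1)
  have hφ : a - ∑' i : ℕ, θ (k + 1 + i) - (a - ∑' i : ℕ, θ (k + i)) = θ k := by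
    rw [hS]; ring
  generalize a - ∑' i : ℕ, θ (k + i) = x at *
  generalize a - ∑' i : ℕ, θ (k + 1 + i) = y at *
  have hcx : 0 < Real.cos x := Real.cos_pos_of_mem_Ioo hA
  have hcy : 0 < Real.cos y := Real.cos_pos_of_mem_Ioo hB
  have hTT : Real.tan x < Real.tan y :=
    Real.tan_lt_tan_of_lt_of_lt_pi_div_two hA.1 hB.2 (by linarith)
  have e1 : t k ^ 2 = 1 + Real.tan x ^ 2 := by
    rw [htA, Real.tan_eq_sin_div_cos]
    field_simp
    linarith [Real.sin_sq_add_cos_sq x]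
  have e2 : t (k + 1) ^ 2 = 1 + Real.tan y ^ 2 := by
    rw [htB, Real.tan_eq_sin_div_cos]
    field_simp
    linarith [Real.sin_sq_add_cos_sq y]
  have e3 : t k * t (k + 1) * Real.cos (θ k) = 1 + Real.tan x * Real.tan y := by
    rw [htA, htB, Real.tan_eq_sin_div_cos, Real.tan_eq_sin_div_cos, ← hφ, Real.cos_sub]
    field_simp
  rw [hθ k hk1, Real.cos_sub] at e3
  have key : ∀ s : ℝ, ‖p k + s • (p (k + 1) - p k)‖ ^ 2
      = 2 * (1 + ((1 - s) * Real.tan x + s * Real.tan y) ^ 2) := by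
    intro s
    obtain ⟨a0, a1, a2⟩ := hp k
    obtain ⟨b0, b1, b2⟩ := hp (k + 1)
    rw [EuclideanSpace.norm_sq_eq]
    simp only [Fin.sum_univ_three, PiLp.add_apply, PiLp.smul_apply, PiLp.sub_apply, smul_eq_mul,
      Real.norm_eq_abs, sq_abs, a0, a1, a2, b0, b1, b2]
    have c1 := Real.sin_sq_add_cos_sq (ξ k)
    have c2 := Real.sin_sq_add_cos_sq (ξ (k + 1))
    linear_combination 2 * (1 - s) ^ 2 * e1 + 2 * s ^ 2 * e2 + 4 * s * (1 - s) * e3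
      + (1 - s) ^ 2 * t k ^ 2 * c1 + s ^ 2 * t (k + 1) ^ 2 * c2
  apply le_antisymm
  · have hne : Real.tan y - Real.tan x ≠ 0 := (sub_pos.mpr hTT).ne'
    set s := - Real.tan x / (Real.tan y - Real.tan x) with hs
    have h0 : (1 - s) * Real.tan x + s * Real.tan y = 0 := by
      rw [hs]; field_simp; ring
    have hmem : p k + s • (p (k + 1) - p k) ∈
        {y | ∃ s : ℝ, y = p k + s • (p (k + 1) - p k)} := ⟨s, rfl⟩
    refine (Metric.infDist_le_dist_of_mem hmem).trans ?_
    rw [dist_zero_left]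
    apply Real.le_sqrt_of_sq_le
    rw [key, h0]; norm_num
  · have hnon : {y | ∃ s : ℝ, y = p k + s • (p (k + 1) - p k)}.Nonempty :=
      ⟨p k, 0, by simp⟩
    rw [Metric.le_infDist hnon]
    rintro _ ⟨s, rfl⟩
    rw [dist_zero_left]
    apply Real.sqrt_le_iff.mpr ⟨norm_nonneg _, ?_⟩
    rw [key]
    nlinarith [sq_nonneg ((1 - s) * Real.tan x + s * Real.tan y)]
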